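/- Let k be an algebraically closed field with char k ≠ 2. In Sp₈(k), let s = diag(-1, -1, 1, 1, -1, -1, 1, 1) and r = diag(-1, 1, -1, 1, -1, 1, -1, 1). Then the joint centralizer {A ∈ Sp₈(k) : A s = s A and A r = r A} is isomorphic, as a group, to SL₂(k) × SL₂(k) × SL₂(k) × SL₂(k). (This is the computation underlying the paper's Remark that the centralizer of r inside the pseudo-Levi subgroup M = centralizer of s is of type A₁ × A₁ × A₁ × A₁, and hence a pseudo-Levi subgroup of a pseudo-Levi subgroup need not be a pseudo-Levi subgroup of Sp₈.) -/

import Mathlib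

open Matrix

/-- The matrix `J = [[0, -I₄], [I₄, 0]]` defining the symplectic form on `k⁸`. -/
def J8 (k : Type*) [Field k] : Matrix (Fin 8) (Fin 8) k :=
  Matrix.reindex finSumFinEquiv finSumFinEquiv
    (Matrix.fromBlocks (0 : Matrix (Fin 4) (Fin 4) k) (-1 : Matrix (Fin 4) (Fin 4) k)
      (1 : Matrix (Fin 4) (Fin 4) k) (0 : Matrix (Fin 4) (Fin 4) k))

/-- The semisimple element `s = diag(-1, -1, 1, 1, -1, -1, 1, 1)`. -/
def s8 (k : Type*) [Field k] : Matrix (Fin 8) (Fin 8) k :=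
  Matrix.diagonal ![(-1 : k), -1, 1, 1, -1, -1, 1, 1]

/-- The semisimple element `r = diag(-1, 1, -1, 1, -1, 1, -1, 1)`. -/
def r8 (k : Type*) [Field k] : Matrix (Fin 8) (Fin 8) k :=
  Matrix.diagonal ![(-1 : k), 1, -1, 1, -1, 1, -1, 1]

/-- The joint centralizer `{A ∈ Sp₈(k) : A s = s A and A r = r A}` of `s` and `r` in the
symplectic group `Sp₈(k) = {A : Aᵀ J A = J}`, realized as a subgroup of the group of
invertible `8 × 8` matrices over `k`. -/
def Sp8JointCentralizer (k : Type*) [Field k] : Subgroup (Matrix (Fin 8) (Fin 8) k)ˣ where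
  carrier := {A | (A : Matrix (Fin 8) (Fin 8) k)ᵀ * J8 k * (A : Matrix (Fin 8) (Fin 8) k) = J8 k ∧
    (A : Matrix (Fin 8) (Fin 8) k) * s8 k = s8 k * (A : Matrix (Fin 8) (Fin 8) k) ∧
    (A : Matrix (Fin 8) (Fin 8) k) * r8 k = r8 k * (A : Matrix (Fin 8) (Fin 8) k)}
  one_mem' := by simp
  mul_mem' := by
    rintro a b ⟨ha1, ha2, ha3⟩ ⟨hb1, hb2, hb3⟩
    refine ⟨?_, ?_, ?_⟩
    · have key : ((a * b : (Matrix (Fin 8) (Fin 8) k)ˣ) : Matrix (Fin 8) (Fin 8) k)ᵀ * J8 k *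
          ((a * b : (Matrix (Fin 8) (Fin 8) k)ˣ) : Matrix (Fin 8) (Fin 8) k) =
          (b : Matrix (Fin 8) (Fin 8) k)ᵀ *
            ((a : Matrix (Fin 8) (Fin 8) k)ᵀ * J8 k * (a : Matrix (Fin 8) (Fin 8) k)) *
            (b : Matrix (Fin 8) (Fin 8) k) := by
        rw [Units.val_mul, Matrix.transpose_mul]
        noncomm_ring
      rw [key, ha1, hb1]
    · rw [Units.val_mul, mul_assoc, hb2, ← mul_assoc, ha2, mul_assoc]
    · rw [Units.val_mul, mul_assoc, hb3, ← mul_assoc, ha3, mul_assoc]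
  inv_mem' := by
    rintro a ⟨ha1, ha2, ha3⟩
    have comm : ∀ x : Matrix (Fin 8) (Fin 8) k,
        (a : Matrix (Fin 8) (Fin 8) k) * x = x * (a : Matrix (Fin 8) (Fin 8) k) →
        ((a⁻¹ : (Matrix (Fin 8) (Fin 8) k)ˣ) : Matrix (Fin 8) (Fin 8) k) * x =
          x * ((a⁻¹ : (Matrix (Fin 8) (Fin 8) k)ˣ) : Matrix (Fin 8) (Fin 8) k) := by
      intro x hx
      calc ((a⁻¹ : (Matrix (Fin 8) (Fin 8) k)ˣ) : Matrix (Fin 8) (Fin 8) k) * x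
          = ↑a⁻¹ * x * ((a : Matrix (Fin 8) (Fin 8) k) * ↑a⁻¹) := by
            rw [Units.mul_inv, mul_one]
        _ = ↑a⁻¹ * (x * (a : Matrix (Fin 8) (Fin 8) k)) * ↑a⁻¹ := by noncomm_ring
        _ = ↑a⁻¹ * ((a : Matrix (Fin 8) (Fin 8) k) * x) * ↑a⁻¹ := by rw [hx]
        _ = ((↑a⁻¹ : Matrix (Fin 8) (Fin 8) k) * a) * (x * ↑a⁻¹) := by noncomm_ring
        _ = x * ↑a⁻¹ := by rw [Units.inv_mul, one_mul]
    refine ⟨?_, comm _ ha2, comm _ ha3⟩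
    calc ((a⁻¹ : (Matrix (Fin 8) (Fin 8) k)ˣ) : Matrix (Fin 8) (Fin 8) k)ᵀ * J8 k *
          ((a⁻¹ : (Matrix (Fin 8) (Fin 8) k)ˣ) : Matrix (Fin 8) (Fin 8) k)
        = (↑a⁻¹ : Matrix (Fin 8) (Fin 8) k)ᵀ *
            ((a : Matrix (Fin 8) (Fin 8) k)ᵀ * J8 k * (a : Matrix (Fin 8) (Fin 8) k)) *
            (↑a⁻¹ : Matrix (Fin 8) (Fin 8) k) := by rw [ha1]
      _ = ((a : Matrix (Fin 8) (Fin 8) k) * ↑a⁻¹)ᵀ * J8 k *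
            ((a : Matrix (Fin 8) (Fin 8) k) * ↑a⁻¹) := by
            rw [Matrix.transpose_mul]; noncomm_ring
      _ = J8 k := by rw [Units.mul_inv]; simp

/-- block-diagonal embedding of four `2 × 2` matrices. -/
noncomputable def phi8 (k : Type*) [Field k] :
    (Fin 4 → Matrix (Fin 2) (Fin 2) k) →+* Matrix (Fin 8) (Fin 8) k :=
  ((Matrix.reindexAlgEquiv k k (finProdFinEquiv (m := 2) (n := 4))).toRingEquiv.toRingHom).comp
    (Matrix.blockDiagonalRingHom (Fin 2) (Fin 4) k)

lemma phi8_apply {k : Type*} [Field k] (M : Fin 4 → Matrix (Fin 2) (Fin 2) k) (a b : Fin 2)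
    (i j : Fin 4) :
    phi8 k M (finProdFinEquiv (a, i)) (finProdFinEquiv (b, j)) = if i = j then M i a b else 0 := by
  simp [phi8, Matrix.blockDiagonal_apply]

lemma ext8 {k : Type*} [Field k] {A B : Matrix (Fin 8) (Fin 8) k}
    (h : ∀ (a b : Fin 2) (i j : Fin 4), A (finProdFinEquiv (a, i)) (finProdFinEquiv (b, j)) =
      B (finProdFinEquiv (a, i)) (finProdFinEquiv (b, j))) : A = B := by
  ext x y
  obtain ⟨⟨a, i⟩, rfl⟩ := (finProdFinEquiv (m := 2) (n := 4)).surjective x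
  obtain ⟨⟨b, j⟩, rfl⟩ := (finProdFinEquiv (m := 2) (n := 4)).surjective y
  exact h a b i j

lemma phi8_inj {k : Type*} [Field k] : Function.Injective (phi8 k) := by
  intro M N h
  funext i
  ext a b
  have := congrFun (congrFun h (finProdFinEquiv (a, i))) (finProdFinEquiv (b, i))
  rw [phi8_apply, phi8_apply] at this
  simpa using this

lemma phi8_transpose {k : Type*} [Field k] (M : Fin 4 → Matrix (Fin 2) (Fin 2) k) :
    (phi8 k M)ᵀ = phi8 k (fun i => (M i)ᵀ) := by
  apply ext8
  intro a b i j
  rw [Matrix.transpose_apply, phi8_apply, phi8_apply]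
  by_cases h : i = j
  · subst h; simp
  · simp [h, Ne.symm h]

lemma J8_eq {k : Type*} [Field k] : J8 k = phi8 k (fun _ => !![0, -1; 1, 0]) := by
  apply ext8
  intro a b i j
  rw [phi8_apply]
  have h0 : ∀ i : Fin 4, (finProdFinEquiv (m := 2) (n := 4)) (0, i)
      = finSumFinEquiv (m := 4) (n := 4) (Sum.inl i) := by decide
  have h1 : ∀ i : Fin 4, (finProdFinEquiv (m := 2) (n := 4)) (1, i)
      = finSumFinEquiv (m := 4) (n := 4) (Sum.inr i) := by decide
  have e0 : ∀ x, (finSumFinEquiv (m := 4) (n := 4)).symm (finSumFinEquiv x) = x :=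
    fun x => Equiv.symm_apply_apply _ x
  unfold J8
  fin_cases a <;> fin_cases b <;>
    simp only [Fin.zero_eta, Fin.mk_one, Fin.isValue, h0, h1, Matrix.reindex_apply,
      Matrix.submatrix_apply, e0] <;>
    simp [Matrix.one_apply] <;> split_ifs <;> simp

lemma diag8 {k : Type*} [Field k] (w : Fin 8 → k) (v : Fin 4 → k)
    (h : ∀ (a : Fin 2) (i : Fin 4), w (finProdFinEquiv (a, i)) = v i) :
    Matrix.diagonal w = phi8 k (fun i => v i • 1) := by
  apply ext8
  intro a b i j
  rw [phi8_apply, Matrix.diagonal_apply, h]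
  have e : (finProdFinEquiv (a, i) : Fin 8) = finProdFinEquiv (b, j) ↔ a = b ∧ i = j := by
    rw [(finProdFinEquiv (m := 2) (n := 4)).injective.eq_iff, Prod.mk.injEq]
  rw [Matrix.smul_apply, Matrix.one_apply, smul_eq_mul]
  by_cases hi : i = j <;> by_cases ha : a = b
  · rw [if_pos (e.2 ⟨ha, hi⟩), if_pos hi, if_pos ha, mul_one]
  · rw [if_neg (fun h => ha (e.1 h).1), if_pos hi, if_neg ha, mul_zero]
  · rw [if_neg (fun h => hi (e.1 h).2), if_neg hi]
  · rw [if_neg (fun h => hi (e.1 h).2), if_neg hi]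

lemma s8_vec {k : Type*} [Field k] (a : Fin 2) (i : Fin 4) :
    ![(-1 : k), -1, 1, 1, -1, -1, 1, 1] (finProdFinEquiv (a, i)) = ![(-1 : k), -1, 1, 1] i := by
  fin_cases a <;> fin_cases i <;> rfl

lemma r8_vec {k : Type*} [Field k] (a : Fin 2) (i : Fin 4) :
    ![(-1 : k), 1, -1, 1, -1, 1, -1, 1] (finProdFinEquiv (a, i)) = ![(-1 : k), 1, -1, 1] i := by
  fin_cases a <;> fin_cases i <;> rfl

lemma two_by_two {k : Type*} [Field k] (M : Matrix (Fin 2) (Fin 2) k) :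
    Mᵀ * !![0, -1; 1, 0] * M = M.det • !![0, -1; 1, 0] := by
  ext i j
  fin_cases i <;> fin_cases j <;>
    simp [Matrix.mul_apply, Fin.sum_univ_two, Matrix.det_fin_two] <;> ring

lemma phi8_symp {k : Type*} [Field k] (M : Fin 4 → Matrix (Fin 2) (Fin 2) k) :
    (phi8 k M)ᵀ * J8 k * phi8 k M = J8 k ↔ ∀ i, (M i).det = 1 := by
  rw [phi8_transpose, J8_eq, ← map_mul, ← map_mul, phi8_inj.eq_iff, funext_iff]
  refine forall_congr' fun i => ?_
  rw [Pi.mul_apply, Pi.mul_apply, two_by_two]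
  constructor
  · intro h
    simpa using congrFun (congrFun h 1) 0
  · intro h
    rw [h, one_smul]

lemma phi8_comm {k : Type*} [Field k] (M : Fin 4 → Matrix (Fin 2) (Fin 2) k) :
    phi8 k M * s8 k = s8 k * phi8 k M ∧ phi8 k M * r8 k = r8 k * phi8 k M := by
  rw [s8, r8, diag8 _ _ s8_vec, diag8 _ _ r8_vec, ← map_mul, ← map_mul, ← map_mul, ← map_mul]
  constructor <;> congr 1 <;> funext i <;> simp

lemma exists_phi8 {k : Type*} [Field k] (h2 : (2 : k) ≠ 0) (A : Matrix (Fin 8) (Fin 8) k)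
    (hs : A * s8 k = s8 k * A) (hr : A * r8 k = r8 k * A) : ∃ M, phi8 k M = A := by
  refine ⟨fun i => Matrix.of fun a b => A (finProdFinEquiv (a, i)) (finProdFinEquiv (b, i)), ?_⟩
  apply ext8
  intro a b i j
  rw [phi8_apply]
  have e1 : ∀ x : k, x = -x → x = 0 := by
    intro x hx
    have : 2 * x = 0 := by linear_combination hx
    exact (mul_eq_zero.mp this).resolve_left h2
  have e2 : ∀ x : k, -x = x → x = 0 := fun x hx => e1 x hx.symm
  have hs' := congrFun (congrFun hs (finProdFinEquiv (a, i))) (finProdFinEquiv (b, j))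
  have hr' := congrFun (congrFun hr (finProdFinEquiv (a, i))) (finProdFinEquiv (b, j))
  rw [s8, Matrix.mul_diagonal, Matrix.diagonal_mul, s8_vec, s8_vec] at hs'
  rw [r8, Matrix.mul_diagonal, Matrix.diagonal_mul, r8_vec, r8_vec] at hr'
  split_ifs with hij
  · subst hij; rfl
  · symm
    generalize hx : A (finProdFinEquiv (a, i)) (finProdFinEquiv (b, j)) = x at hs' hr'
    clear hx hs hr
    fin_cases i <;> fin_cases j <;>
    first
    | exact absurd rfl hij
    | (simp at hs'; first | exact e1 _ hs' | exact e2 _ hs' | exact hs')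
    | (simp at hr'; first | exact e1 _ hr' | exact e2 _ hr' | exact hr')

/-- the four factors as a family. -/
def four8 (G : Type*) [Group G] : G × G × G × G →* (Fin 4 → G) where
  toFun p := ![p.1, p.2.1, p.2.2.1, p.2.2.2]
  map_one' := by funext i; fin_cases i <;> rfl
  map_mul' p q := by funext i; fin_cases i <;> rfl

lemma four8_bij (G : Type*) [Group G] : Function.Bijective (four8 G) := by
  constructor
  · rintro ⟨a, b, c, d⟩ ⟨a', b', c', d'⟩ h
    have h0 := congrFun h 0
    have h1 := congrFun h 1
    have h2 := congrFun h 2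
    have h3 := congrFun h 3
    simp [four8] at h0 h1 h2 h3
    simp [h0, h1, h2, h3]
  · intro f
    refine ⟨(f 0, f 1, f 2, f 3), ?_⟩
    funext i; fin_cases i <;> rfl

/-- the underlying family of matrices. -/
def coe8 (k : Type*) [Field k] :
    (Fin 4 → Matrix.SpecialLinearGroup (Fin 2) k) →* (Fin 4 → Matrix (Fin 2) (Fin 2) k) where
  toFun f i := (f i : Matrix (Fin 2) (Fin 2) k)
  map_one' := by funext i; simp
  map_mul' p q := by funext i; simp

/-- the isomorphism as a homomorphism. -/
noncomputable def psi8 (k : Type*) [Field k] :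
    (Fin 4 → Matrix.SpecialLinearGroup (Fin 2) k) →* Sp8JointCentralizer k :=
  (MonoidHom.toHomUnits ((phi8 k).toMonoidHom.comp (coe8 k))).codRestrict
    (Sp8JointCentralizer k) (fun f => ⟨(phi8_symp _).2 fun i => (f i).2,
      (phi8_comm (coe8 k f)).1, (phi8_comm (coe8 k f)).2⟩)

lemma psi8_coe {k : Type*} [Field k] (f : Fin 4 → Matrix.SpecialLinearGroup (Fin 2) k) :
    ((psi8 k f : (Matrix (Fin 8) (Fin 8) k)ˣ) : Matrix (Fin 8) (Fin 8) k)
      = phi8 k (fun i => (f i : Matrix (Fin 2) (Fin 2) k)) := rfl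

lemma psi8_bij {k : Type*} [Field k] (h2 : (2 : k) ≠ 0) : Function.Bijective (psi8 k) := by
  constructor
  · intro f g h
    have h' : phi8 k (fun i => (f i : Matrix (Fin 2) (Fin 2) k))
        = phi8 k (fun i => (g i : Matrix (Fin 2) (Fin 2) k)) := by
      rw [← psi8_coe, ← psi8_coe, h]
    funext i
    exact Subtype.ext (congrFun (phi8_inj h') i)
  · rintro ⟨A, h1, hs, hr⟩
    obtain ⟨M, hM⟩ := exists_phi8 h2 _ hs hr
    rw [← hM, phi8_symp] at h1
    refine ⟨fun i => ⟨M i, h1 i⟩, ?_⟩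
    apply Subtype.ext
    apply Units.ext
    exact (psi8_coe _).trans hM

/-- Let `k` be an algebraically closed field with `char k ≠ 2`.  In
`Sp₈(k)`, the joint centralizer of `s = diag(-1,-1,1,1,-1,-1,1,1)` and
`r = diag(-1,1,-1,1,-1,1,-1,1)` is isomorphic, as a group, to
`SL₂(k) × SL₂(k) × SL₂(k) × SL₂(k)`. -/
theorem sp8_joint_centralizer_iso_four_SL2 (k : Type*) [Field k] [IsAlgClosed k]
    (hchar : ringChar k ≠ 2) :
    Nonempty (Sp8JointCentralizer k ≃*
      Matrix.SpecialLinearGroup (Fin 2) k × Matrix.SpecialLinearGroup (Fin 2) k ×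
        Matrix.SpecialLinearGroup (Fin 2) k × Matrix.SpecialLinearGroup (Fin 2) k) := by
  have h2 : (2 : k) ≠ 0 := Ring.two_ne_zero hchar
  exact ⟨(MulEquiv.ofBijective ((psi8 k).comp (four8 _))
    ((psi8_bij h2).comp (four8_bij _))).symm⟩
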